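/- Let k be an algebraically closed field of characteristic 0 and q ∈ k^×. In the free algebra k⟨x_1,x_2,x_3⟩ define z_1 := x_2x_3 − q·x_3x_2. Let A be the quotient of k⟨x_1,x_2,x_3⟩ by the two-sided ideal generated by: x_1², x_2², x_1x_2 + x_2x_1, z_1², x_3·z_1 − q^{−1}·z_1·x_3, and x_1x_3 − q·x_3x_1. Then the images of the monomials x_1^{m_1}·x_2^{m_2}·x_3^{m_3}·z_1^{m_4}, with m_1, m_2, m_4 ∈ {0,1} and m_3 ∈ ℕ, form a k-basis of A, and GKdim A = 1. (A is the Endymion Nichols algebra B(eny_+(q)) of a pale block and a point with q_22 = 1.) -/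

import Mathlib

open scoped ENNReal

/-- The Gelfand–Kirillov dimension of a `k`-algebra `A`. -/
noncomputable def GKdim (k A : Type*) [Field k] [Ring A] [Algebra k A] : ℝ≥0∞ :=
  ⨆ (V : Submodule k A) (_ : FiniteDimensional k V),
    Filter.limsup
      (fun n : ℕ =>
        ENNReal.ofReal
          (Real.log ((Module.finrank k (↥(∑ j ∈ Finset.range (n + 1), V ^ j)) : ℕ) : ℝ) /
            Real.log (n : ℝ)))
      Filter.atTop

/-- The generator `x_{i+1}` of the free algebra `k⟨x₁,x₂,x₃⟩`. -/
noncomputable def X (k : Type*) [Field k] (i : Fin 3) : FreeAlgebra k (Fin 3) :=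
  FreeAlgebra.ι k i

/-- `z₁ := x₂x₃ − q x₃x₂`. -/
noncomputable def z1 (k : Type*) [Field k] (q : k) : FreeAlgebra k (Fin 3) :=
  X k 1 * X k 2 - q • (X k 2 * X k 1)

/-- The defining relations of the Endymion algebra `B(eny₊(q))`. -/
def enyRel (k : Type*) [Field k] (q : k)
    (a b : FreeAlgebra k (Fin 3)) : Prop :=
  b = 0 ∧
    (a = X k 0 * X k 0 ∨
     a = X k 1 * X k 1 ∨
     a = X k 0 * X k 1 + X k 1 * X k 0 ∨
     a = z1 k q * z1 k q ∨
     a = X k 2 * z1 k q - q⁻¹ • (z1 k q * X k 2) ∨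
     a = X k 0 * X k 2 - q • (X k 2 * X k 0))

/-- The PBW monomials `x₁^{m₁} x₂^{m₂} x₃^{m₃} z₁^{m₄}`, `m₁, m₂, m₄ ∈ {0,1}`, `m₃ ∈ ℕ`. -/
noncomputable def bas (k : Type*) [Field k] (q : k)
    (p : Fin 2 × Fin 2 × ℕ × Fin 2) : RingQuot (enyRel k q) :=
  RingQuot.mkAlgHom k (enyRel k q)
    (X k 0 ^ ((p.1 : ℕ)) * X k 1 ^ ((p.2.1 : ℕ)) * X k 2 ^ p.2.2.1 *
      z1 k q ^ ((p.2.2.2 : ℕ)))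

namespace Eny

variable {k : Type*} [Field k]

/-- The index set of the PBW monomials. -/
abbrev Idx := Fin 2 × Fin 2 × ℕ × Fin 2

/-- Left multiplication by `x₁` in the PBW basis. -/
noncomputable def opA (k : Type*) [Field k] : Module.End k (Idx →₀ k) :=
  Finsupp.linearCombination k fun p =>
    if p.1 = 0 then Finsupp.single (1, p.2.1, p.2.2.1, p.2.2.2) 1 else 0

/-- Left multiplication by `x₂` in the PBW basis. -/
noncomputable def opB (k : Type*) [Field k] : Module.End k (Idx →₀ k) :=
  Finsupp.linearCombination k fun p =>
    if p.2.1 = 0 then ((-1 : k) ^ (p.1 : ℕ)) • Finsupp.single (p.1, 1, p.2.2.1, p.2.2.2) 1 else 0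

/-- Left multiplication by `x₃` in the PBW basis. -/
noncomputable def opC (q : k) : Module.End k (Idx →₀ k) :=
  Finsupp.linearCombination k fun p =>
    (q⁻¹ ^ (p.1 : ℕ) * q⁻¹ ^ (p.2.1 : ℕ)) •
        Finsupp.single (p.1, p.2.1, p.2.2.1 + 1, p.2.2.2) (1 : k) -
      if p.2.1 = 1 ∧ p.2.2.2 = 0 then
        (q⁻¹ ^ (p.1 : ℕ) * q⁻¹ * q ^ p.2.2.1) • Finsupp.single (p.1, 0, p.2.2.1, 1) (1 : k)
      else 0

/-- Left multiplication by `z₁` in the PBW basis. -/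
noncomputable def opZ (q : k) : Module.End k (Idx →₀ k) :=
  Finsupp.linearCombination k fun p =>
    if p.2.2.2 = 0 then
      ((-q⁻¹) ^ (p.1 : ℕ) * (-q⁻¹) ^ (p.2.1 : ℕ) * q ^ p.2.2.1) •
        Finsupp.single (p.1, p.2.1, p.2.2.1, 1) (1 : k)
    else 0

lemma end_ext {f g : Module.End k (Idx →₀ k)}
    (h : ∀ i j n l, f (Finsupp.single (i, j, n, l) 1) = g (Finsupp.single (i, j, n, l) 1)) :
    f = g := by
  refine Finsupp.lhom_ext' fun p => LinearMap.ext_ring ?_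
  exact h p.1 p.2.1 p.2.2.1 p.2.2.2

lemma opA_mul_opA : opA k * opA k = 0 := by
  refine end_ext fun i j n l => ?_
  fin_cases i <;> simp [opA]

lemma opB_mul_opB : opB k * opB k = 0 := by
  refine end_ext fun i j n l => ?_
  fin_cases j <;> simp [opB]

lemma opA_mul_opB : opA k * opB k + opB k * opA k = 0 := by
  refine end_ext fun i j n l => ?_
  fin_cases i <;> fin_cases j <;> simp [opA, opB]

lemma opZ_mul_opZ (q : k) : opZ q * opZ q = 0 := by
  refine end_ext fun i j n l => ?_
  fin_cases l <;> simp [opZ, -Finsupp.smul_single, -Finsupp.single_mul]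

lemma opB_opC {q : k} (hq : q ≠ 0) : opB k * opC q - q • (opC q * opB k) = opZ q := by
  refine end_ext fun i j n l => ?_
  fin_cases i <;> fin_cases j <;> fin_cases l <;>
    simp [opB, opC, opZ, -Finsupp.smul_single, -Finsupp.single_mul] <;>
    match_scalars <;> field_simp <;> ring

lemma opC_opZ {q : k} (hq : q ≠ 0) : opC q * opZ q - q⁻¹ • (opZ q * opC q) = 0 := by
  refine end_ext fun i j n l => ?_
  fin_cases i <;> fin_cases j <;> fin_cases l <;>
    simp [opC, opZ, -Finsupp.smul_single, -Finsupp.single_mul] <;>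
    match_scalars <;> field_simp <;> ring

lemma opA_opC {q : k} (hq : q ≠ 0) : opA k * opC q - q • (opC q * opA k) = 0 := by
  refine end_ext fun i j n l => ?_
  fin_cases i <;> fin_cases j <;> fin_cases l <;>
    simp [opA, opC, -Finsupp.smul_single, -Finsupp.single_mul] <;>
    match_scalars <;> field_simp <;> ring

/-- The action of the free algebra on the span of the PBW monomials. -/
noncomputable def freeRep (q : k) : FreeAlgebra k (Fin 3) →ₐ[k] Module.End k (Idx →₀ k) :=
  FreeAlgebra.lift k ![opA k, opB k, opC q]

@[simp] lemma freeRep_X0 (q : k) : freeRep q (X k 0) = opA k := by simp [freeRep, X]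

@[simp] lemma freeRep_X1 (q : k) : freeRep q (X k 1) = opB k := by simp [freeRep, X]

@[simp] lemma freeRep_X2 (q : k) : freeRep q (X k 2) = opC q := by simp [freeRep, X]

lemma freeRep_z1 {q : k} (hq : q ≠ 0) : freeRep q (z1 k q) = opZ q := by
  simp [z1, opB_opC hq]

/-- The action of `B(eny₊(q))` on the span of the PBW monomials. -/
noncomputable def rep {q : k} (hq : q ≠ 0) :
    RingQuot (enyRel k q) →ₐ[k] Module.End k (Idx →₀ k) :=
  RingQuot.liftAlgHom k ⟨freeRep q, by
    rintro a b ⟨rfl, rfl | rfl | rfl | rfl | rfl | rfl⟩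
    · simp [opA_mul_opA]
    · simp [opB_mul_opB]
    · simp [opA_mul_opB]
    · simp [freeRep_z1 hq, opZ_mul_opZ]
    · simpa [freeRep_z1 hq] using opC_opZ hq
    · simpa using opA_opC hq⟩

lemma opC_pow (q : k) (n : ℕ) (l : Fin 2) :
    (opC q ^ n) (Finsupp.single (0, 0, 0, l) 1) = Finsupp.single (0, 0, n, l) 1 := by
  induction n with
  | zero => simp
  | succ n ih =>
    rw [pow_succ', Module.End.mul_apply, ih]
    simp [opC, -Finsupp.smul_single, -Finsupp.single_mul]

lemma rep_bas {q : k} (hq : q ≠ 0) (p : Idx) :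
    rep hq (bas k q p) (Finsupp.single (0, 0, 0, 0) 1) = Finsupp.single p 1 := by
  obtain ⟨i, j, n, l⟩ := p
  have hz : (opZ q ^ (l : ℕ)) (Finsupp.single (0, 0, 0, 0) 1) = Finsupp.single (0, 0, 0, l) 1 := by
    fin_cases l <;> simp [opZ, -Finsupp.smul_single, -Finsupp.single_mul]
  simp only [bas, rep, RingQuot.liftAlgHom_mkAlgHom_apply, map_mul, map_pow, freeRep_X0,
    freeRep_X1, freeRep_X2, freeRep_z1 hq, Module.End.mul_apply, hz, opC_pow]
  fin_cases i <;> fin_cases j <;> simp [opA, opB]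

lemma linearIndependent_bas {q : k} (hq : q ≠ 0) : LinearIndependent k (bas k q) := by
  refine LinearIndependent.of_comp
    ((LinearMap.applyₗ (Finsupp.single ((0, 0, 0, 0) : Idx) (1 : k))).comp
      (rep hq).toLinearMap) ?_
  convert (Finsupp.basisSingleOne (R := k) (ι := Idx)).linearIndependent using 1
  ext1 p
  simpa using rep_bas hq p

/-- The image of `x_{i+1}` in `B(eny₊(q))`. -/
noncomputable abbrev gen (q : k) (i : Fin 3) : RingQuot (enyRel k q) :=
  RingQuot.mkAlgHom k (enyRel k q) (X k i)

/-- The image of `z₁` in `B(eny₊(q))`. -/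
noncomputable abbrev genZ (q : k) : RingQuot (enyRel k q) :=
  RingQuot.mkAlgHom k (enyRel k q) (z1 k q)

lemma bas_eq (q : k) (i j : Fin 2) (n : ℕ) (l : Fin 2) :
    bas k q (i, j, n, l) =
      gen q 0 ^ (i : ℕ) * gen q 1 ^ (j : ℕ) * gen q 2 ^ n * genZ q ^ (l : ℕ) := by
  simp [bas]

lemma mk_eq_zero {q : k} {a : FreeAlgebra k (Fin 3)} (h : enyRel k q a 0) :
    RingQuot.mkAlgHom k (enyRel k q) a = 0 := by
  simpa using RingQuot.mkAlgHom_rel k h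

lemma gen0_sq (q : k) : gen q 0 * gen q 0 = 0 := by
  simpa using mk_eq_zero (q := q) ⟨rfl, Or.inl rfl⟩

lemma gen1_sq (q : k) : gen q 1 * gen q 1 = 0 := by
  simpa using mk_eq_zero (q := q) ⟨rfl, Or.inr (Or.inl rfl)⟩

lemma gen1_gen0 (q : k) : gen q 1 * gen q 0 = (-1 : k) • (gen q 0 * gen q 1) := by
  have h := mk_eq_zero (q := q) ⟨rfl, Or.inr (Or.inr (Or.inl rfl))⟩
  rw [map_add, map_mul, map_mul] at h
  have h' : gen q 0 * gen q 1 + (-1 : k) • (gen q 0 * gen q 1) = 0 := by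
    nth_rewrite 1 [← one_smul k (gen q 0 * gen q 1)]
    rw [← add_smul, add_neg_cancel, zero_smul]
  exact add_left_cancel (h.trans h'.symm)

lemma genZ_sq (q : k) : genZ q * genZ q = 0 := by
  simpa using mk_eq_zero (q := q) ⟨rfl, Or.inr (Or.inr (Or.inr (Or.inl rfl)))⟩

lemma genZ_gen2 {q : k} (hq : q ≠ 0) : genZ q * gen q 2 = q • (gen q 2 * genZ q) := by
  have h := mk_eq_zero (q := q) ⟨rfl, Or.inr (Or.inr (Or.inr (Or.inr (Or.inl rfl))))⟩
  rw [map_sub, map_smul, map_mul, map_mul, sub_eq_zero] at h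
  rw [h, smul_smul, mul_inv_cancel₀ hq, one_smul]

lemma gen2_gen0 {q : k} (hq : q ≠ 0) : gen q 2 * gen q 0 = q⁻¹ • (gen q 0 * gen q 2) := by
  have h := mk_eq_zero (q := q) ⟨rfl, Or.inr (Or.inr (Or.inr (Or.inr (Or.inr rfl))))⟩
  rw [map_sub, map_smul, map_mul, map_mul, sub_eq_zero] at h
  rw [h, smul_smul, inv_mul_cancel₀ hq, one_smul]

lemma gen2_gen1 {q : k} (hq : q ≠ 0) :
    gen q 2 * gen q 1 = q⁻¹ • (gen q 1 * gen q 2 - genZ q) := by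
  have h : genZ q = gen q 1 * gen q 2 - q • (gen q 2 * gen q 1) := by
    rw [genZ, z1, map_sub, map_smul, map_mul, map_mul]
  rw [h, sub_sub_cancel, smul_smul, inv_mul_cancel₀ hq, one_smul]

lemma genZ_gen2_pow {q : k} (hq : q ≠ 0) (n : ℕ) :
    genZ q * gen q 2 ^ n = q ^ n • (gen q 2 ^ n * genZ q) := by
  induction n with
  | zero => simp
  | succ n ih =>
    rw [pow_succ, ← mul_assoc, ih, smul_mul_assoc, mul_assoc, genZ_gen2 hq, mul_smul_comm,
      smul_smul, ← mul_assoc, pow_succ]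

/-- The span of the PBW monomials whose exponent of `x₃` is at most `d`. -/
noncomputable def filt (q : k) (d : ℕ) : Submodule k (RingQuot (enyRel k q)) :=
  Submodule.span k (bas k q '' {p | p.2.2.1 ≤ d})

lemma bas_mem_filt (q : k) {i j : Fin 2} {n d : ℕ} {l : Fin 2} (h : n ≤ d) :
    bas k q (i, j, n, l) ∈ filt q d :=
  Submodule.subset_span ⟨_, h, rfl⟩

lemma filt_mono (q : k) {d e : ℕ} (h : d ≤ e) : filt q d ≤ filt q e :=
  Submodule.span_mono (Set.image_mono fun _ hp => le_trans hp h)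

lemma one_mem_filt (q : k) (d : ℕ) : 1 ∈ filt q d := by
  simpa [bas_eq] using bas_mem_filt q (i := 0) (j := 0) (l := 0) (Nat.zero_le d)

lemma mul_mem_filt {q : k} {x : RingQuot (enyRel k q)} {d e : ℕ}
    (h : ∀ i j n l, n ≤ d → x * bas k q (i, j, n, l) ∈ filt q e)
    {y : RingQuot (enyRel k q)} (hy : y ∈ filt q d) : x * y ∈ filt q e := by
  have : filt q d ≤ (filt q e).comap (LinearMap.mulLeft k x) := by
    refine Submodule.span_le.2 ?_
    rintro _ ⟨⟨i, j, n, l⟩, hp, rfl⟩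
    exact h i j n l hp
  exact this hy

lemma gen0_mul_bas (q : k) (i j : Fin 2) (n : ℕ) (l : Fin 2) :
    gen q 0 * bas k q (i, j, n, l) = if i = 0 then bas k q (1, j, n, l) else 0 := by
  fin_cases i <;> simp [bas_eq, ← mul_assoc, gen0_sq]

lemma gen1_mul_bas (q : k) (i j : Fin 2) (n : ℕ) (l : Fin 2) :
    gen q 1 * bas k q (i, j, n, l) =
      if j = 0 then (-1 : k) ^ (i : ℕ) • bas k q (i, 1, n, l) else 0 := by
  fin_cases i <;> fin_cases j <;> simp [bas_eq, ← mul_assoc, gen1_sq, gen1_gen0]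
  rw [mul_assoc (gen q 0), gen1_sq, mul_zero, zero_mul, zero_mul]

lemma gen2_mul_bas_zero {q : k} (hq : q ≠ 0) (i : Fin 2) (n : ℕ) (l : Fin 2) :
    gen q 2 * bas k q (i, 0, n, l) = q⁻¹ ^ (i : ℕ) • bas k q (i, 0, n + 1, l) := by
  fin_cases i <;> simp [bas_eq, ← mul_assoc, gen2_gen0 hq, pow_succ']

lemma gen2_gen0_pow {q : k} (hq : q ≠ 0) (i : Fin 2) :
    gen q 2 * gen q 0 ^ (i : ℕ) = q⁻¹ ^ (i : ℕ) • (gen q 0 ^ (i : ℕ) * gen q 2) := by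
  fin_cases i <;> simp [gen2_gen0 hq]

lemma gen2_mul_bas_one {q : k} (hq : q ≠ 0) (i : Fin 2) (n : ℕ) (l : Fin 2) :
    gen q 2 * bas k q (i, 1, n, l) =
      (q⁻¹ ^ (i : ℕ) * q⁻¹) • (bas k q (i, 1, n + 1, l) -
        if l = 0 then q ^ n • bas k q (i, 0, n, 1) else 0) := by
  have key : gen q 2 * gen q 1 * gen q 2 ^ n * genZ q ^ (l : ℕ) =
      q⁻¹ • (gen q 1 * gen q 2 ^ (n + 1) * genZ q ^ (l : ℕ) -
        if l = 0 then q ^ n • (gen q 2 ^ n * genZ q) else 0) := by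
    rw [gen2_gen1 hq, smul_mul_assoc, smul_mul_assoc, sub_mul, sub_mul, genZ_gen2_pow hq,
      mul_assoc (gen q 1), ← pow_succ']
    fin_cases l
    · simp
    · simp [mul_assoc, genZ_sq]
  have h1 : gen q 2 * bas k q (i, 1, n, l) = q⁻¹ ^ (i : ℕ) •
      (gen q 0 ^ (i : ℕ) * (gen q 2 * gen q 1 * gen q 2 ^ n * genZ q ^ (l : ℕ))) := by
    rw [bas_eq, ← mul_assoc, ← mul_assoc, ← mul_assoc, gen2_gen0_pow hq]
    simp only [smul_mul_assoc, mul_assoc, Fin.val_one, pow_one]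
  rw [h1, key, mul_smul_comm, smul_smul, mul_sub]
  split_ifs <;> simp [bas_eq, mul_assoc]

lemma gen_mul_mem_filt {q : k} (hq : q ≠ 0) (i : Fin 3) {d : ℕ} {y : RingQuot (enyRel k q)}
    (hy : y ∈ filt q d) : gen q i * y ∈ filt q (d + 1) := by
  refine mul_mem_filt (fun i' j n l hn => ?_) hy
  fin_cases i
  · change gen q 0 * _ ∈ _
    rw [gen0_mul_bas]
    split_ifs
    · exact bas_mem_filt q (by omega)
    · exact zero_mem _
  · change gen q 1 * _ ∈ _
    rw [gen1_mul_bas]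
    split_ifs
    · exact Submodule.smul_mem _ _ (bas_mem_filt q (by omega))
    · exact zero_mem _
  · change gen q 2 * _ ∈ _
    obtain rfl | rfl : j = 0 ∨ j = 1 := by omega
    · rw [gen2_mul_bas_zero hq]
      exact Submodule.smul_mem _ _ (bas_mem_filt q (by omega))
    · rw [gen2_mul_bas_one hq]
      refine Submodule.smul_mem _ _ (sub_mem (bas_mem_filt q (by omega)) ?_)
      split_ifs
      · exact Submodule.smul_mem _ _ (bas_mem_filt q (by omega))
      · exact zero_mem _

lemma exists_mul_mem_filt {q : k} (hq : q ≠ 0) (x : RingQuot (enyRel k q)) :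
    ∃ m, ∀ d, ∀ y ∈ filt q d, x * y ∈ filt q (d + m) := by
  obtain ⟨w, rfl⟩ := RingQuot.mkAlgHom_surjective k (enyRel k q) x
  induction w using FreeAlgebra.induction with
  | grade0 r =>
    refine ⟨0, fun d y hy => ?_⟩
    rw [AlgHom.commutes, ← Algebra.smul_def]
    exact Submodule.smul_mem _ _ hy
  | grade1 i => exact ⟨1, fun d y hy => gen_mul_mem_filt hq i hy⟩
  | mul a b ha hb =>
    obtain ⟨m, hm⟩ := ha
    obtain ⟨m', hm'⟩ := hb
    refine ⟨m' + m, fun d y hy => ?_⟩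
    rw [map_mul, mul_assoc, ← add_assoc]
    exact hm _ _ (hm' _ _ hy)
  | add a b ha hb =>
    obtain ⟨m, hm⟩ := ha
    obtain ⟨m', hm'⟩ := hb
    refine ⟨m + m', fun d y hy => ?_⟩
    rw [map_add, add_mul]
    exact add_mem (filt_mono q (by omega) (hm _ _ hy)) (filt_mono q (by omega) (hm' _ _ hy))

lemma span_bas {q : k} (hq : q ≠ 0) : Submodule.span k (Set.range (bas k q)) = ⊤ := by
  refine eq_top_iff.2 fun x _ => ?_
  obtain ⟨m, hm⟩ := exists_mul_mem_filt hq x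
  have := hm 0 1 (one_mem_filt q 0)
  rw [mul_one] at this
  exact Submodule.span_mono (Set.image_subset_range _ _) this

lemma filt_eq_span_range (q : k) (d : ℕ) :
    filt q d = Submodule.span k (Set.range fun p : Fin 2 × Fin 2 × Fin (d + 1) × Fin 2 =>
      bas k q (p.1, p.2.1, p.2.2.1, p.2.2.2)) := by
  unfold filt
  congr 1
  ext x
  constructor
  · rintro ⟨⟨i, j, n, l⟩, hp, rfl⟩
    exact ⟨(i, j, ⟨n, Nat.lt_succ_of_le hp⟩, l), rfl⟩
  · rintro ⟨⟨i, j, n, l⟩, rfl⟩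
    exact ⟨_, Nat.le_of_lt_succ n.2, rfl⟩

instance (q : k) (d : ℕ) : FiniteDimensional k (filt q d) := by
  rw [filt_eq_span_range]
  exact FiniteDimensional.span_of_finite k (Set.finite_range _)

lemma finrank_filt_le (q : k) (d : ℕ) : Module.finrank k (filt q d) ≤ 8 * (d + 1) := by
  rw [filt_eq_span_range]
  refine (finrank_range_le_card _).trans ?_
  simp only [Fintype.card_prod, Fintype.card_fin]
  omega

lemma exists_submodule_mul_le_filt {q : k} (hq : q ≠ 0)
    (V : Submodule k (RingQuot (enyRel k q))) [FiniteDimensional k V] :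
    ∃ m, ∀ d, V * filt q d ≤ filt q (d + m) := by
  obtain ⟨s, rfl⟩ : V.FG := (Submodule.fg_iff_finiteDimensional V).2 inferInstance
  choose m hm using exists_mul_mem_filt hq
  refine ⟨s.sup m, fun d => ?_⟩
  have hs : Submodule.span k (s : Set (RingQuot (enyRel k q))) ≤
      (⨅ y : filt q d, (filt q (d + s.sup m)).comap (LinearMap.mulRight k (y : RingQuot _))) := by
    refine Submodule.span_le.2 fun x hx => ?_
    simp only [SetLike.mem_coe, Submodule.mem_iInf, Submodule.mem_comap]
    exact fun y => filt_mono q (Nat.add_le_add_left (Finset.le_sup hx) d) (hm x d y y.2)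
  refine Submodule.mul_le.2 fun x hx y hy => ?_
  have := hs hx
  simp only [Submodule.mem_iInf] at this
  exact this ⟨y, hy⟩

lemma sum_pow_le_filt {q : k} {V : Submodule k (RingQuot (enyRel k q))} {m : ℕ}
    (h : ∀ d, V * filt q d ≤ filt q (d + m)) (n : ℕ) :
    ∑ j ∈ Finset.range (n + 1), V ^ j ≤ filt q (n * m) := by
  have hpow : ∀ j, V ^ j ≤ filt q (j * m) := fun j => by
    induction j with
    | zero => simpa [Submodule.one_le] using one_mem_filt q 0
    | succ j ih =>
      rw [pow_succ', Nat.succ_mul]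
      exact (mul_le_mul' le_rfl ih).trans (h _)
  refine Finset.sum_induction _ (· ≤ filt q (n * m)) (fun _ _ => sup_le) bot_le fun j hj => ?_
  exact (hpow j).trans (filt_mono q
    (Nat.mul_le_mul_right m (Nat.le_of_lt_succ (Finset.mem_range.1 hj))))

lemma limsup_le_one {q : k} (hq : q ≠ 0)
    (V : Submodule k (RingQuot (enyRel k q))) [FiniteDimensional k V] :
    Filter.limsup (fun n : ℕ => ENNReal.ofReal
      (Real.log ((Module.finrank k (↥(∑ j ∈ Finset.range (n + 1), V ^ j)) : ℕ) : ℝ) /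
        Real.log (n : ℝ))) Filter.atTop ≤ 1 := by
  obtain ⟨m, hm⟩ := exists_submodule_mul_le_filt hq V
  set K : ℝ := 8 * (m + 1) with hK
  have hKpos : 0 < K := by positivity
  have hlim : Filter.Tendsto (fun n : ℕ => ENNReal.ofReal (Real.log K / Real.log (n : ℝ) + 1))
      Filter.atTop (nhds 1) := by
    have h0 : Filter.Tendsto (fun n : ℕ => Real.log K / Real.log (n : ℝ) + 1)
        Filter.atTop (nhds (0 + 1)) :=
      (Filter.Tendsto.div_atTop tendsto_const_nhds
        (Real.tendsto_log_atTop.comp tendsto_natCast_atTop_atTop)).add_const 1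
    simpa using ENNReal.tendsto_ofReal h0
  rw [← hlim.limsup_eq]
  refine Filter.limsup_le_limsup ?_
  filter_upwards [Filter.eventually_ge_atTop 2] with n hn
  have hn' : (2 : ℝ) ≤ n := by exact_mod_cast hn
  have hlog : 0 < Real.log n := Real.log_pos (by linarith)
  refine ENNReal.ofReal_le_ofReal ?_
  rw [div_le_iff₀ hlog, add_mul, one_mul, div_mul_cancel₀ _ hlog.ne',
    ← Real.log_mul hKpos.ne' (by positivity)]
  have hdim := (Submodule.finrank_mono (sum_pow_le_filt hm n)).trans (finrank_filt_le q (n * m))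
  have hbound : ((Module.finrank k (↥(∑ j ∈ Finset.range (n + 1), V ^ j)) : ℕ) : ℝ) ≤ K * n := by
    refine (Nat.cast_le.2 hdim).trans ?_
    push_cast
    rw [hK]
    nlinarith
  rcases Nat.eq_zero_or_pos (Module.finrank k (↥(∑ j ∈ Finset.range (n + 1), V ^ j))) with h0 | h0
  · rw [h0, Nat.cast_zero, Real.log_zero]
    refine Real.log_nonneg ?_
    rw [hK]
    nlinarith [(Nat.cast_nonneg m : (0 : ℝ) ≤ m)]
  · exact Real.log_le_log (by exact_mod_cast h0) hbound

lemma le_finrank_sum_pow {q : k} (hq : q ≠ 0) (n : ℕ) :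
    n + 1 ≤ Module.finrank k
      (↥(∑ j ∈ Finset.range (n + 1), Submodule.span k {gen q 2} ^ j)) := by
  obtain ⟨m, hm⟩ := exists_submodule_mul_le_filt hq (Submodule.span k {gen q 2})
  have hfin := Submodule.finiteDimensional_of_le (sum_pow_le_filt hm n)
  have hmem : ∀ j : Fin (n + 1), bas k q (0, 0, j, 0) ∈
      ∑ j ∈ Finset.range (n + 1), Submodule.span k {gen q 2} ^ j := fun j => by
    refine Finset.single_le_sum (f := fun j => Submodule.span k {gen q 2} ^ j)
      (fun _ _ => bot_le) (Finset.mem_range.2 j.2) ?_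
    simpa [bas_eq] using
      Submodule.pow_mem_pow _ (Submodule.mem_span_singleton_self (R := k) (gen q 2)) (j : ℕ)
  have hli : LinearIndependent k fun j : Fin (n + 1) => bas k q (0, 0, j, 0) :=
    (linearIndependent_bas hq).comp (fun j : Fin (n + 1) => ((0, 0, j, 0) : Idx))
      fun a b h => by simpa [Fin.ext_iff] using h
  have hli' : LinearIndependent k fun j : Fin (n + 1) =>
      (⟨_, hmem j⟩ : ↥(∑ j ∈ Finset.range (n + 1), Submodule.span k {gen q 2} ^ j)) :=
    LinearIndependent.of_comp (Submodule.subtype _) hli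
  simpa using hli'.fintype_card_le_finrank

lemma GKdim_eq_one {q : k} (hq : q ≠ 0) : GKdim k (RingQuot (enyRel k q)) = 1 := by
  refine le_antisymm (iSup₂_le fun V _ => limsup_le_one hq V) ?_
  refine le_iSup₂_of_le (Submodule.span k {gen q 2}) inferInstance ?_
  refine Filter.le_limsup_of_frequently_le (Filter.Eventually.frequently ?_)
  filter_upwards [Filter.eventually_ge_atTop 2] with n hn
  have hn' : (2 : ℝ) ≤ n := by exact_mod_cast hn
  rw [← ENNReal.ofReal_one]
  refine ENNReal.ofReal_le_ofReal ?_
  rw [one_le_div (Real.log_pos (by linarith))]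
  refine Real.log_le_log (by linarith) ?_
  exact_mod_cast (Nat.le_succ n).trans (le_finrank_sum_pow hq n)

end Eny

/-- The PBW monomials form a basis of `B(eny₊(q))`, and
`GKdim B(eny₊(q)) = 1`. -/
theorem statement15 (k : Type*) [Field k] [IsAlgClosed k] [CharZero k]
    (q : k) (hq : q ≠ 0) :
    (LinearIndependent k (bas k q) ∧
      Submodule.span k (Set.range (bas k q)) = ⊤) ∧
    GKdim k (RingQuot (enyRel k q)) = 1 := by
  exact ⟨⟨Eny.linearIndependent_bas hq, Eny.span_bas hq⟩, Eny.GKdim_eq_one hq⟩
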